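/- Let (𝒜, α) be a weighted system that is non-defective and set ρ = ρ(𝒜, α). Then (𝒜, α) possesses an extremal norm: there exists a norm ‖·‖ on ℝ^d such that, in the induced operator norm, ‖ρ^{−α_j}A_j‖ ≤ 1 for every j = 1, …, m. -/

import Mathlib

open Filter

attribute [local instance] Matrix.linftyOpNormedRing

/-- The product `A(k)⋯A(1)` associated with the word `w = (i_1, …, i_k)`. -/
noncomputable def wordProd {d m : ℕ} (A : Fin m → Matrix (Fin d) (Fin d) ℝ)
    (w : List (Fin m)) : Matrix (Fin d) (Fin d) ℝ :=
  ((w.map A).reverse).prod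

/-- The total weight `α(k)+⋯+α(1)` of the word `w = (i_1, …, i_k)`. -/
def wordWeight {m : ℕ} (α : Fin m → ℝ) (w : List (Fin m)) : ℝ :=
  (w.map α).sum

/-- `ρ_k`: the maximum of `‖A(k)⋯A(1)‖^(1/(α(k)+⋯+α(1)))` over products of length `k`. -/
noncomputable def rhoSeq {d m : ℕ} (A : Fin m → Matrix (Fin d) (Fin d) ℝ)
    (α : Fin m → ℝ) (k : ℕ) : ℝ :=
  sSup {r : ℝ | ∃ w : List (Fin m), w.length = k ∧
    r = ‖wordProd A w‖ ^ (1 / wordWeight α w)}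

/-- The `α`-weighted joint spectral radius `ρ(𝒜, α) = limsup_{k→∞} ρ_k`. -/
noncomputable def wjsr {d m : ℕ} (A : Fin m → Matrix (Fin d) (Fin d) ℝ)
    (α : Fin m → ℝ) : ℝ :=
  limsup (rhoSeq A α) atTop

theorem wordProd_cons {d m : ℕ} (A : Fin m → Matrix (Fin d) (Fin d) ℝ) (j : Fin m)
    (w : List (Fin m)) : wordProd A (j :: w) = wordProd A w * A j := by
  simp [wordProd]

theorem wordProd_rpow_smul {d m : ℕ} (A : Fin m → Matrix (Fin d) (Fin d) ℝ) (α : Fin m → ℝ)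
    {r : ℝ} (hr : 0 < r) (w : List (Fin m)) :
    wordProd (fun j => r ^ (-α j) • A j) w = r ^ (-wordWeight α w) • wordProd A w := by
  induction w with
  | nil => simp [wordProd, wordWeight]
  | cons j w ih =>
    have hweight : wordWeight α (j :: w) = α j + wordWeight α w := by simp [wordWeight]
    rw [wordProd_cons, wordProd_cons, ih, hweight, neg_add, Real.rpow_add hr, smul_mul_smul_comm,
      mul_comm (r ^ (-α j))]

theorem rhoSeq_nonneg {d m : ℕ} (A : Fin m → Matrix (Fin d) (Fin d) ℝ) (α : Fin m → ℝ) (k : ℕ) :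
    0 ≤ rhoSeq A α k := by
  apply Real.sSup_nonneg
  rintro _ ⟨w, -, rfl⟩
  positivity

theorem wjsr_nonneg {d m : ℕ} (A : Fin m → Matrix (Fin d) (Fin d) ℝ) (α : Fin m → ℝ) :
    0 ≤ wjsr A α := by
  rw [wjsr, limsup_eq]
  apply Real.sInf_nonneg
  intro a ha
  obtain ⟨k, hk⟩ := Eventually.exists ha
  exact (rhoSeq_nonneg A α k).trans hk

/-- A family of matrices generating a bounded semigroup is nonexpansive in some norm. -/
theorem exists_norm_mulVec_le_of_bounded {d m : ℕ} (B : Fin m → Matrix (Fin d) (Fin d) ℝ)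
    {C : ℝ} (hC : ∀ w, ‖wordProd B w‖ ≤ C) :
    ∃ N : Seminorm ℝ (Fin d → ℝ), (∀ x, x ≠ 0 → 0 < N x) ∧
      ∀ j x, N ((B j).mulVec x) ≤ N x := by
  let p : List (Fin m) → Seminorm ℝ (Fin d → ℝ) := fun w =>
    (normSeminorm ℝ (Fin d → ℝ)).comp (wordProd B w).mulVecLin
  have hp : ∀ w x, p w x = ‖(wordProd B w).mulVec x‖ := fun _ _ => rfl
  have hbdd : ∀ x, BddAbove (Set.range fun w => p w x) := by
    intro x
    refine ⟨C * ‖x‖, ?_⟩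
    rintro _ ⟨w, rfl⟩
    exact (Matrix.linfty_opNorm_mulVec _ _).trans (by grw [hC w])
  have hN : ∀ x, (⨆ w, p w) x = ⨆ w, p w x := fun x =>
    Seminorm.iSup_apply (Seminorm.bddAbove_range_iff.2 hbdd)
  refine ⟨⨆ w, p w, fun x hx => ?_, fun j x => ?_⟩
  · rw [hN]
    refine (norm_pos_iff.2 hx).trans_le ?_
    simpa [hp, wordProd] using le_ciSup (hbdd x) []
  · rw [hN, hN]
    refine ciSup_le fun w => ?_
    simpa [hp, wordProd_cons, Matrix.mulVec_mulVec] using le_ciSup (hbdd x) (j :: w)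

/-- **Theorem 2.12 b).** A non-defective weighted system possesses an extremal
norm `N`: the induced operator norm of `ρ^{-α_j}A_j` is `≤ 1` for every `j`,
where `ρ = ρ(𝒜, α)`. -/
theorem exists_extremal_norm_of_nondefective {d m : ℕ} (hm : 0 < m)
    (A : Fin m → Matrix (Fin d) (Fin d) ℝ)
    (α : Fin m → ℝ) (hα : ∀ i, 0 < α i)
    (hnd : ∃ C : ℝ, 0 < C ∧ ∀ w : List (Fin m), w ≠ [] →
      ‖wordProd A w‖ ≤ C * wjsr A α ^ wordWeight α w) :
    ∃ N : Seminorm ℝ (Fin d → ℝ), (∀ x : Fin d → ℝ, x ≠ 0 → 0 < N x) ∧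
      ∀ j : Fin m,
        sSup {c : ℝ | ∃ x : Fin d → ℝ, N x = 1 ∧
          c = N (((wjsr A α ^ (-(α j))) • A j).mulVec x)} ≤ 1 := by
  obtain ⟨C, hC0, hC⟩ := hnd
  set r := wjsr A α with hr
  suffices h : ∃ D, ∀ w, ‖wordProd (fun j => r ^ (-α j) • A j) w‖ ≤ D by
    obtain ⟨D, hD⟩ := h
    obtain ⟨N, hpos, hle⟩ := exists_norm_mulVec_le_of_bounded _ hD
    refine ⟨N, hpos, fun j => Real.sSup_le ?_ zero_le_one⟩
    rintro _ ⟨x, hx, rfl⟩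
    exact (hle j x).trans hx.le
  refine ⟨max C ‖(1 : Matrix (Fin d) (Fin d) ℝ)‖, fun w => ?_⟩
  by_cases hw : w = []
  · simp [hw, wordProd]
  refine le_max_of_le_left ?_
  rcases (wjsr_nonneg A α).eq_or_lt with h0 | h0
  · obtain ⟨j, v, rfl⟩ := List.exists_cons_of_ne_nil hw
    have hj : r ^ (-α j) = 0 := by
      rw [hr, ← h0, Real.zero_rpow (neg_ne_zero.2 (hα j).ne')]
    simpa [wordProd_cons, hj] using hC0.le
  · let : NormedAlgebra ℝ (Matrix (Fin d) (Fin d) ℝ) := Matrix.linftyOpNormedAlgebra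
    rw [wordProd_rpow_smul A α h0, norm_smul, Real.norm_of_nonneg (by positivity),
      Real.rpow_neg h0.le, inv_mul_le_iff₀ (Real.rpow_pos_of_pos h0 _), mul_comm]
    exact hC w hw
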